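/- Fix n ≥ 1 and m ≥ 2, and let A : (Δ^{m−1})^n → Δ^{m−1} be a mechanism that is truthful, neutral, and continuous. Let α_1, …, α_n ∈ [0,1] and γ ∈ [0,1] satisfy A(p(α_1), …, p(α_n)) = p(γ). If min_{i} α_i ≤ 1/m ≤ max_{i} α_i, then min_{i} α_i ≤ γ ≤ max_{i} α_i. -/

import Mathlib

open scoped Classical BigOperators

/-- The standard simplex Δ^{m-1} as a subset of ℝ^m. -/
def simplex (m : ℕ) : Set (Fin m → ℝ) :=
  {x | (∀ j, 0 ≤ x j) ∧ ∑ j, x j = 1}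

/-- ℓ1-distance on ℝ^m. -/
noncomputable def dist1 {m : ℕ} (x y : Fin m → ℝ) : ℝ :=
  ∑ j, |x j - y j|

/-- A mechanism is truthful if no voter can decrease the ℓ1-distance of the result
to her true report by misreporting. -/
def Truthful {n m : ℕ} (A : (Fin n → Fin m → ℝ) → (Fin m → ℝ)) : Prop :=
  ∀ P : Fin n → Fin m → ℝ, (∀ i, P i ∈ simplex m) →
    ∀ i : Fin n, ∀ q ∈ simplex m,
      dist1 (P i) (A P) ≤ dist1 (P i) (A (Function.update P i q))

/-- Neutrality: the outcome is equivariant under permutations of the alternatives. -/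
def Neutral {n m : ℕ} (A : (Fin n → Fin m → ℝ) → (Fin m → ℝ)) : Prop :=
  ∀ P : Fin n → Fin m → ℝ, (∀ i, P i ∈ simplex m) →
    ∀ σ : Equiv.Perm (Fin m), A (fun i j => P i (σ j)) = fun j => A P (σ j)

/-- The symmetric vote p(α) = (α, (1-α)/(m-1), …, (1-α)/(m-1)). -/
noncomputable def pvec (m : ℕ) (α : ℝ) : Fin m → ℝ :=
  fun j => if (j : ℕ) = 0 then α else (1 - α) / ((m : ℝ) - 1)

lemma pvec_mem_simplex {m : ℕ} (hm : 2 ≤ m) {t : ℝ} (ht : t ∈ Set.Icc (0 : ℝ) 1) :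
    pvec m t ∈ simplex m := by
  obtain ⟨k, rfl⟩ : ∃ k, m = k + 1 := ⟨m - 1, by omega⟩
  have hk : (1 : ℝ) ≤ k := by exact_mod_cast (by omega : 1 ≤ k)
  refine ⟨fun j => ?_, ?_⟩
  · unfold pvec
    split_ifs
    · exact ht.1
    · push_cast
      exact div_nonneg (by linarith [ht.2]) (by linarith)
  · have hk0 : (k : ℝ) ≠ 0 := by linarith
    rw [Fin.sum_univ_succ]
    simp [pvec]
    field_simp
    ring

lemma dist1_pvec {m : ℕ} (hm : 2 ≤ m) (s t : ℝ) :
    dist1 (pvec m s) (pvec m t) = 2 * |s - t| := by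
  obtain ⟨k, rfl⟩ : ∃ k, m = k + 1 := ⟨m - 1, by omega⟩
  have hk : (0 : ℝ) < k := by exact_mod_cast (by omega : 0 < k)
  have h : (1 - s) / (k : ℝ) - (1 - t) / k = (t - s) / k := by ring
  rw [dist1, Fin.sum_univ_succ]
  simp [pvec, h, abs_div, abs_of_pos hk, abs_sub_comm t s]
  field_simp
  ring

lemma continuous_pvec (m : ℕ) : Continuous (pvec m) := by
  refine continuous_pi fun j => ?_
  unfold pvec
  split_ifs <;> fun_prop

lemma pvec_uniform {m : ℕ} (hm : 2 ≤ m) : pvec m (1 / m) = fun _ => 1 / (m : ℝ) := by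
  have h2 : (2 : ℝ) ≤ m := by exact_mod_cast hm
  have h0 : (m : ℝ) ≠ 0 := by linarith
  have h1 : (m : ℝ) - 1 ≠ 0 := by linarith
  funext j
  unfold pvec
  split_ifs
  · rfl
  · field_simp

/-- A point of the simplex fixed by the permutations fixing the first coordinate is a `pvec`. -/
lemma eq_pvec_of_mem_simplex {m : ℕ} (hm : 2 ≤ m) {a : Fin m → ℝ} (ha : a ∈ simplex m)
    (h : ∀ j k : Fin m, (j : ℕ) ≠ 0 → (k : ℕ) ≠ 0 → a j = a k) :
    a = pvec m (a ⟨0, by omega⟩) := by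
  obtain ⟨k, rfl⟩ : ∃ k, m = k + 1 := ⟨m - 1, by omega⟩
  have hk : (k : ℝ) ≠ 0 := by exact_mod_cast (by omega : k ≠ 0)
  funext j
  unfold pvec
  split_ifs with hj
  · congr 1
    exact Fin.ext hj
  · have hs := ha.2
    rw [Fin.sum_univ_succ,
      Finset.sum_congr rfl fun i _ => h (Fin.succ i) j (by simp) hj] at hs
    simp only [Finset.sum_const, Finset.card_univ, Fintype.card_fin, nsmul_eq_mul] at hs
    rw [eq_div_iff (by push_cast; simpa using hk), show (⟨0, by omega⟩ : Fin (k + 1)) = 0 from rfl]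
    push_cast
    linarith

lemma Neutral.apply_eq_apply {n m : ℕ} {A : (Fin n → Fin m → ℝ) → (Fin m → ℝ)}
    (hA : Neutral A) {P : Fin n → Fin m → ℝ} (hP : ∀ i, P i ∈ simplex m) {j k : Fin m}
    (h : ∀ i l, P i (Equiv.swap j k l) = P i l) : A P j = A P k := by
  have := congrFun (hA P hP (Equiv.swap j k)) j
  simpa [h] using this

lemma Neutral.exists_eq_pvec {n m : ℕ} (hm : 2 ≤ m) {A : (Fin n → Fin m → ℝ) → (Fin m → ℝ)}
    (hA : Neutral A)
    (hmap : ∀ P : Fin n → Fin m → ℝ, (∀ i, P i ∈ simplex m) → A P ∈ simplex m)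
    {x : Fin n → ℝ} (hx : ∀ i, x i ∈ Set.Icc (0 : ℝ) 1) :
    A (fun i => pvec m (x i)) =
      pvec m (A (fun i => pvec m (x i)) ⟨0, by omega⟩) := by
  have hP : ∀ i, pvec m (x i) ∈ simplex m := fun i => pvec_mem_simplex hm (hx i)
  refine eq_pvec_of_mem_simplex hm (hmap _ hP) fun j k hj hk =>
    hA.apply_eq_apply hP fun i l => ?_
  rcases eq_or_ne l j with rfl | hlj
  · simp [pvec, hj, hk]
  rcases eq_or_ne l k with rfl | hlk
  · simp [pvec, hj, hk]
  rw [Equiv.swap_apply_of_ne_of_ne hlj hlk]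

/-- If a continuous `g` makes truthful reporting optimal for a voter whose cost is the distance to
her peak, then it cannot leave an interval containing both her peak and some attained outcome. -/
lemma mem_Icc_of_truthful {s : Set ℝ} [s.OrdConnected] {g : ℝ → ℝ} (hg : ContinuousOn g s)
    (htruth : ∀ x ∈ s, ∀ y ∈ s, |x - g x| ≤ |x - g y|) {l u x y : ℝ} (hx : x ∈ s) (hy : y ∈ s)
    (hxlu : x ∈ Set.Icc l u) (hgy : g y ∈ Set.Icc l u) : g x ∈ Set.Icc l u := by
  have hsub : Set.uIcc y x ⊆ s := Set.OrdConnected.uIcc_subset ‹_› hy hx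
  have hivt := intermediate_value_uIcc (hg.mono hsub)
  refine ⟨le_of_not_gt fun hlt => ?_, le_of_not_gt fun hlt => ?_⟩
  · obtain ⟨z, hz, hgz⟩ := hivt (Set.mem_uIcc.2 (.inr ⟨hlt.le, hgy.1⟩))
    have := htruth x hx z (hsub hz)
    rw [hgz, abs_of_nonneg (by linarith [hxlu.1]), abs_of_nonneg (by linarith [hxlu.1])] at this
    linarith
  · obtain ⟨z, hz, hgz⟩ := hivt (Set.mem_uIcc.2 (.inl ⟨hgy.2, hlt.le⟩))
    have := htruth x hx z (hsub hz)
    rw [hgz, abs_of_nonpos (by linarith [hxlu.2]), abs_of_nonpos (by linarith [hxlu.2])] at this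
    linarith

/-- if the votes on the segment bracket 1/m, then the aggregate p(γ)
lies between the minimum and maximum vote parameters. -/
theorem stmt4 (n m : ℕ) (hn : 1 ≤ n) (hm : 2 ≤ m)
    (A : (Fin n → Fin m → ℝ) → (Fin m → ℝ))
    (hmap : ∀ P : Fin n → Fin m → ℝ, (∀ i, P i ∈ simplex m) → A P ∈ simplex m)
    (htruth : Truthful A)
    (hneut : Neutral A)
    (hcont : ContinuousOn A {P : Fin n → Fin m → ℝ | ∀ i, P i ∈ simplex m})
    (α : Fin n → ℝ) (hα : ∀ i, α i ∈ Set.Icc (0 : ℝ) 1)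
    (γ : ℝ) (hγ : γ ∈ Set.Icc (0 : ℝ) 1)
    (hagg : A (fun i => pvec m (α i)) = pvec m γ)
    (hlow : (⨅ i, α i) ≤ (1 : ℝ) / m) (hhigh : (1 : ℝ) / m ≤ ⨆ i, α i) :
    (⨅ i, α i) ≤ γ ∧ γ ≤ ⨆ i, α i := by
  have hm0 : 0 < m := by omega
  have hm2 : (2 : ℝ) ≤ m := by exact_mod_cast hm
  have : Nonempty (Fin n) := ⟨⟨0, hn⟩⟩
  let F : (Fin n → ℝ) → ℝ := fun x => A (fun i => pvec m (x i)) ⟨0, hm0⟩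
  have hF : ∀ x : Fin n → ℝ, (∀ i, x i ∈ Set.Icc (0 : ℝ) 1) →
      A (fun i => pvec m (x i)) = pvec m (F x) := fun x hx => hneut.exists_eq_pvec hm hmap hx
  have hupd : ∀ x : Fin n → ℝ, (∀ i, x i ∈ Set.Icc (0 : ℝ) 1) → ∀ i, ∀ t ∈ Set.Icc (0 : ℝ) 1,
      ∀ k, Function.update x i t k ∈ Set.Icc (0 : ℝ) 1 := by
    intro x hx i t ht k
    rcases eq_or_ne k i with rfl | hk
    · simpa using ht
    · simpa [hk] using hx k
  have htr : ∀ x : Fin n → ℝ, (∀ i, x i ∈ Set.Icc (0 : ℝ) 1) → ∀ i, ∀ t ∈ Set.Icc (0 : ℝ) 1,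
      |x i - F x| ≤ |x i - F (Function.update x i t)| := by
    intro x hx i t ht
    have h := htruth _ (fun k => pvec_mem_simplex hm (hx k)) i _ (pvec_mem_simplex hm ht)
    have hu : Function.update (fun k => pvec m (x k)) i (pvec m t) =
        fun k => pvec m (Function.update x i t k) := by
      funext k
      rcases eq_or_ne k i with rfl | hk <;> simp [*]
    rw [hu, hF x hx, hF _ (hupd x hx i t ht), dist1_pvec hm, dist1_pvec hm] at h
    linarith
  have hcts : ∀ x : Fin n → ℝ, (∀ i, x i ∈ Set.Icc (0 : ℝ) 1) → ∀ i,
      ContinuousOn (fun t => F (Function.update x i t)) (Set.Icc 0 1) := by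
    intro x hx i
    have hc : Continuous fun (t : ℝ) k => pvec m (Function.update x i t k) :=
      continuous_pi fun k => (continuous_pvec m).comp <|
        (continuous_apply k).comp (f := fun t : ℝ => Function.update x i t)
          (continuous_const.update i continuous_id)
    exact (continuous_apply _).comp_continuousOn (hcont.comp hc.continuousOn fun t ht k =>
      pvec_mem_simplex hm (hupd x hx i t ht k))
  have hu : (1 : ℝ) / m ∈ Set.Icc (0 : ℝ) 1 :=
    ⟨by positivity, (div_le_one (by linarith)).2 (by linarith)⟩
  have hbound : ∀ i, α i ∈ Set.Icc (⨅ i, α i) (⨆ i, α i) := fun i =>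
    ⟨ciInf_le (Set.finite_range α).bddBelow i, le_ciSup (Set.finite_range α).bddAbove i⟩
  have key : ∀ s : Finset (Fin n),
      F (fun i => if i ∈ s then α i else 1 / m) ∈ Set.Icc (⨅ i, α i) (⨆ i, α i) := by
    intro s
    induction s using Finset.induction_on with
    | empty =>
      have hx : ∀ i : Fin n, (fun _ : Fin n => (1 : ℝ) / m) i ∈ Set.Icc (0 : ℝ) 1 := fun _ => hu
      have hP := fun i => pvec_mem_simplex hm (hx i)
      have hsum := (hmap _ hP).2
      have hconst : ∀ j, A (fun i => pvec m ((fun _ : Fin n => (1 : ℝ) / m) i)) j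
          = F fun _ => 1 / m := fun j =>
        hneut.apply_eq_apply hP fun i l => by simp only [pvec_uniform hm]
      rw [Finset.sum_congr rfl fun j _ => hconst j] at hsum
      simp only [Finset.sum_const, Finset.card_univ, Fintype.card_fin, nsmul_eq_mul] at hsum
      have : F (fun _ => 1 / m) = 1 / m := by
        rw [eq_div_iff (by linarith)]
        linarith
      simp only [Finset.notMem_empty, if_false, this]
      exact ⟨hlow, hhigh⟩
    | insert a s ha ih =>
      set x : Fin n → ℝ := fun i => if i ∈ s then α i else 1 / m with hxdef
      have hx : ∀ i, x i ∈ Set.Icc (0 : ℝ) 1 := by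
        intro i
        simp only [hxdef]
        split_ifs
        exacts [hα i, hu]
      have hins : (fun i => if i ∈ insert a s then α i else 1 / m) =
          Function.update x a (α a) := by
        funext k
        rcases eq_or_ne k a with rfl | hk <;> simp [*]
      rw [hins]
      refine mem_Icc_of_truthful (hcts x hx a) (fun t ht y hy => ?_) (hα a) (hx a) (hbound a)
        (by simpa using ih)
      simpa using htr _ (hupd x hx a t ht) a y hy
  have hfin : F α = γ := by
    have h := congrFun hagg ⟨0, hm0⟩
    simpa [pvec] using h
  simpa [hfin] using key Finset.univ
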